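/- arXiv:2605.01079 — 3 statements merged into one kernel-verified Lean document; each statement's English description precedes it below -/
import Mathlib

section
/- Let α > 0, λ ∈ ℂ, and let k be an integer with 0 ≤ k ≤ ⌈α⌉ − 1. Then for every t > 0 the function t ↦ P_{α,k}(λ,t) is an eigenfunction of the Caputo fractional derivative of order α with eigenvalue λ: (^C D^α) [P_{α,k}(λ,·)](t) = λ P_{α,k}(λ,t). -/
open MeasureTheory

/-- Two-parameter Mittag-Leffler function, using the entire reciprocal Gamma
function (Mathlib's `Complex.Gamma` vanishes at nonpositive integers, so its
inverse is the entire reciprocal Gamma). -/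
noncomputable def mlE (α β : ℝ) (z : ℂ) : ℂ :=
  ∑' n : ℕ, z ^ n * (Complex.Gamma ((α * n + β : ℝ) : ℂ))⁻¹

/-- The `P` function: `P_{α,w}(λ,t) = t^w E_{α,w+1}(λ t^α)`. -/
noncomputable def Pfun (α w : ℝ) (lam : ℂ) (t : ℝ) : ℂ :=
  ((t ^ w : ℝ) : ℂ) * mlE α (w + 1) (lam * ((t ^ α : ℝ) : ℂ))

/-- The `R` (Lorenzo–Hartley) function: `R_{α,v}(λ,t) = t^{α-v-1} E_{α,α-v}(λ t^α)`. -/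
noncomputable def Rfun (α v : ℝ) (lam : ℂ) (t : ℝ) : ℂ :=
  ((t ^ (α - v - 1) : ℝ) : ℂ) * mlE α (α - v) (lam * ((t ^ α : ℝ) : ℂ))

/-- The Caputo fractional derivative of order `α > 0` based at `0`, with `m = ⌈α⌉`:
`(1/Γ(m-α)) ∫_0^t f^(m)(z) (t-z)^(m-α-1) dz` when `α < m`, and `f^(m)(t)` when `α = m`. -/
noncomputable def caputoDeriv (α : ℝ) (f : ℝ → ℂ) (t : ℝ) : ℂ :=
  if α = (⌈α⌉₊ : ℝ) then iteratedDeriv ⌈α⌉₊ f t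
  else ((Real.Gamma ((⌈α⌉₊ : ℝ) - α) : ℝ) : ℂ)⁻¹ *
    ∫ z in (0 : ℝ)..t, iteratedDeriv ⌈α⌉₊ f z * (((t - z) ^ ((⌈α⌉₊ : ℝ) - α - 1) : ℝ) : ℂ)

open Set Filter Topology

/-- Every exponential is eventually dominated by the Gamma function. -/
lemma rpow_mul_exp_neg_le_Gamma {R s : ℝ} (hR : 0 < R) (hs : 1 ≤ s) :
    R ^ (s - 1) * Real.exp (-R) ≤ Real.Gamma s := by
  have hs0 : 0 < s := by linarith
  have hint := Real.GammaIntegral_convergent hs0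
  have hsub : Ioi R ⊆ Ioi (0 : ℝ) := Ioi_subset_Ioi hR.le
  rw [Real.Gamma_eq_integral hs0, ← integral_exp_neg_Ioi R, ← integral_const_mul]
  calc ∫ x in Ioi R, R ^ (s - 1) * Real.exp (-x)
      ≤ ∫ x in Ioi R, Real.exp (-x) * x ^ (s - 1) := by
        refine setIntegral_mono_on ((integrableOn_exp_neg_Ioi R).const_mul _)
          (hint.mono_set hsub) measurableSet_Ioi fun x hx => ?_
        rw [mul_comm]
        gcongr
        · exact (mem_Ioi.1 hx).le
    _ ≤ _ := by
        refine setIntegral_mono_set hint ?_ hsub.eventuallyLE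
        filter_upwards [ae_restrict_mem measurableSet_Ioi] with x hx
        have := mem_Ioi.1 hx
        positivity

/-- The Mittag-Leffler series converges absolutely everywhere. -/
lemma summable_pow_mul_abs_inv_Gamma {α : ℝ} (hα : 0 < α) (β : ℝ) {x : ℝ} (hx : 0 ≤ x) :
    Summable fun n : ℕ => x ^ n * |(Real.Gamma (α * n + β))⁻¹| := by
  set R : ℝ := (2 * x + 1) ^ α⁻¹ with hRdef
  have hR : 0 < R := by positivity
  have hRα : R ^ α = 2 * x + 1 := Real.rpow_inv_rpow (by positivity) hα.ne'
  have hgeo : Summable fun n : ℕ =>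
      Real.exp R * (R ^ (β - 1))⁻¹ * (x / (2 * x + 1)) ^ n := by
    refine (summable_geometric_of_lt_one (by positivity) ?_).mul_left _
    rw [div_lt_one (by positivity)]
    linarith
  refine summable_of_isBigO_nat hgeo (Asymptotics.IsBigO.of_bound 1 ?_)
  have hlim : Tendsto (fun n : ℕ => α * (n : ℝ) + β) atTop atTop :=
    tendsto_atTop_add_const_right _ _ (tendsto_natCast_atTop_atTop.const_mul_atTop hα)
  filter_upwards [hlim.eventually_ge_atTop 1] with n hn
  have hle := rpow_mul_exp_neg_le_Gamma hR hn
  have hpos : 0 < R ^ (α * n + β - 1) * Real.exp (-R) := by positivity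
  have hG : 0 < Real.Gamma (α * n + β) := hpos.trans_le hle
  have hsplit : R ^ (α * n + β - 1) = (2 * x + 1) ^ n * R ^ (β - 1) := by
    rw [add_sub_assoc, Real.rpow_add hR, Real.rpow_mul hR.le, hRα, Real.rpow_natCast]
  rw [abs_of_pos (by positivity), Real.norm_of_nonneg (by positivity),
    Real.norm_of_nonneg (by positivity), one_mul]
  calc x ^ n * (Real.Gamma (α * n + β))⁻¹
      ≤ x ^ n * (R ^ (α * n + β - 1) * Real.exp (-R))⁻¹ := by gcongr
    _ = _ := by
      rw [hsplit, Real.exp_neg, div_pow]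
      field_simp

/-- The summands of the series defining `Pfun α w lam t`. -/
noncomputable def PfunTerm (α w : ℝ) (lam : ℂ) (t : ℝ) (n : ℕ) : ℂ :=
  lam ^ n * ((t ^ (α * n + w) * (Real.Gamma (α * n + w + 1))⁻¹ : ℝ) : ℂ)

lemma Pfun_eq_tsum (α w : ℝ) (lam : ℂ) {t : ℝ} (ht : 0 < t) :
    Pfun α w lam t = ∑' n, PfunTerm α w lam t n := by
  rw [Pfun, mlE, ← tsum_mul_left]
  refine tsum_congr fun n => ?_
  rw [PfunTerm, Complex.Gamma_ofReal, Real.rpow_add ht, Real.rpow_mul ht.le, Real.rpow_natCast,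
    ← add_assoc]
  push_cast
  ring

lemma norm_PfunTerm (α w : ℝ) (lam : ℂ) {t : ℝ} (ht : 0 < t) (n : ℕ) :
    ‖PfunTerm α w lam t n‖ =
      t ^ w * ((‖lam‖ * t ^ α) ^ n * |(Real.Gamma (α * n + (w + 1)))⁻¹|) := by
  rw [PfunTerm, norm_mul, norm_pow, Complex.norm_real, norm_mul, Real.norm_eq_abs,
    Real.norm_eq_abs, abs_of_pos (by positivity), Real.rpow_add ht, Real.rpow_mul ht.le,
    Real.rpow_natCast, ← add_assoc]
  ring

lemma summable_norm_PfunTerm {α : ℝ} (hα : 0 < α) (w : ℝ) (lam : ℂ) {t : ℝ} (ht : 0 < t) :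
    Summable fun n => ‖PfunTerm α w lam t n‖ := by
  simp_rw [norm_PfunTerm α w lam ht]
  exact (summable_pow_mul_abs_inv_Gamma hα _ (by positivity)).mul_left _

lemma hasDerivAt_PfunTerm (α w : ℝ) (lam : ℂ) {t : ℝ} (ht : 0 < t) (n : ℕ) :
    HasDerivAt (fun τ => PfunTerm α w lam τ n) (PfunTerm α (w - 1) lam t n) t := by
  have hrec : (Real.Gamma (α * n + w))⁻¹ = (α * n + w) * (Real.Gamma (α * n + w + 1))⁻¹ := by
    have := Complex.one_div_Gamma_eq_self_mul_one_div_Gamma_add_one ((α * n + w : ℝ) : ℂ)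
    rw [← Complex.ofReal_one, ← Complex.ofReal_add, Complex.Gamma_ofReal,
      Complex.Gamma_ofReal] at this
    exact_mod_cast this
  have h := (((Real.hasDerivAt_rpow_const (p := α * n + w) (Or.inl ht.ne')).mul_const
    (Real.Gamma (α * n + w + 1))⁻¹).ofReal_comp).const_mul (lam ^ n)
  refine h.congr_deriv ?_
  rw [PfunTerm, ← add_sub_assoc, sub_add_cancel, hrec]
  congr 2
  ring

/-- Differentiating lowers the index `w` of the `P` function by one. -/
lemma hasDerivAt_Pfun {α : ℝ} (hα : 0 < α) (w : ℝ) (lam : ℂ) {t : ℝ} (ht : 0 < t) :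
    HasDerivAt (Pfun α w lam) (Pfun α (w - 1) lam t) t := by
  have hmem : t ∈ Ioo (t / 2) (2 * t) := ⟨by linarith, by linarith⟩
  have hu : Summable fun n : ℕ => ((t / 2) ^ (w - 1) + (2 * t) ^ (w - 1)) *
      ((‖lam‖ * (2 * t) ^ α) ^ n * |(Real.Gamma (α * n + (w - 1 + 1)))⁻¹|) :=
    (summable_pow_mul_abs_inv_Gamma hα _ (by positivity)).mul_left _
  have h := hasDerivAt_tsum_of_isPreconnected hu isOpen_Ioo isPreconnected_Ioo
    (g := fun n τ => PfunTerm α w lam τ n) (g' := fun n τ => PfunTerm α (w - 1) lam τ n)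
    (fun n y hy => hasDerivAt_PfunTerm α w lam (by linarith [hy.1]) n)
    (fun n y hy => ?_) hmem (summable_norm_PfunTerm hα w lam ht).of_norm hmem
  · rw [Pfun_eq_tsum α (w - 1) lam ht]
    refine h.congr_of_eventuallyEq ?_
    filter_upwards [lt_mem_nhds ht] with τ hτ using Pfun_eq_tsum α w lam hτ
  · have hy0 : 0 < y := by linarith [hy.1]
    rw [norm_PfunTerm _ _ _ hy0]
    gcongr
    · rcases le_total 0 (w - 1) with hw | hw
      · have := Real.rpow_le_rpow hy0.le hy.2.le hw
        have : 0 < (t / 2) ^ (w - 1) := by positivity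
        linarith
      · have := Real.rpow_le_rpow_of_nonpos (by positivity) hy.1.le hw
        have : 0 < (2 * t) ^ (w - 1) := by positivity
        linarith
    · exact hy.2.le

lemma iteratedDeriv_Pfun {α : ℝ} (hα : 0 < α) (w : ℝ) (lam : ℂ) (m : ℕ) {t : ℝ} (ht : 0 < t) :
    iteratedDeriv m (Pfun α w lam) t = Pfun α (w - m) lam t := by
  induction m generalizing t with
  | zero => simp
  | succ m ih =>
    rw [iteratedDeriv_succ, EventuallyEq.deriv_eq (f := Pfun α (w - m) lam),
      (hasDerivAt_Pfun hα _ lam ht).deriv]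
    · push_cast
      rw [sub_sub]
    · filter_upwards [lt_mem_nhds ht] with τ hτ using ih hτ

/-- If the leading coefficient of `Pfun α w` vanishes, a factor `lam` can be pulled out. -/
lemma Pfun_eq_mul_Pfun_add {α : ℝ} (hα : 0 < α) {w : ℝ} (hw : Real.Gamma (w + 1) = 0) (lam : ℂ)
    {t : ℝ} (ht : 0 < t) : Pfun α w lam t = lam * Pfun α (w + α) lam t := by
  rw [Pfun_eq_tsum α w lam ht, Pfun_eq_tsum α _ lam ht,
    (summable_norm_PfunTerm hα w lam ht).of_norm.tsum_eq_zero_add, ← tsum_mul_left]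
  simp only [PfunTerm, Nat.cast_zero, mul_zero, zero_add, hw, inv_zero, Complex.ofReal_zero]
  refine tsum_congr fun n => ?_
  rw [show α * ((n + 1 : ℕ) : ℝ) + w = α * n + (w + α) by push_cast; ring]
  ring

/-- The Euler beta integral over `[0, t]`. -/
lemma integral_rpow_mul_sub_rpow {a b t : ℝ} (ha : 0 < a) (hb : 0 < b) (ht : 0 < t) :
    ∫ z in (0 : ℝ)..t, z ^ (a - 1) * (t - z) ^ (b - 1) =
      t ^ (a + b - 1) * (Real.Gamma a * Real.Gamma b / Real.Gamma (a + b)) := by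
  have h := Complex.betaIntegral_scaled (a : ℂ) (b : ℂ) ht
  rw [Complex.betaIntegral_eq_Gamma_mul_div _ _ (by simpa) (by simpa), ← Complex.ofReal_add,
    Complex.Gamma_ofReal, Complex.Gamma_ofReal, Complex.Gamma_ofReal] at h
  apply Complex.ofReal_injective
  rw [← intervalIntegral.integral_ofReal]
  push_cast [Complex.ofReal_cpow ht.le] at h ⊢
  rw [← h]
  refine intervalIntegral.integral_congr fun z hz => ?_
  rw [uIcc_of_le ht.le] at hz
  rw [Complex.ofReal_cpow hz.1, Complex.ofReal_cpow (sub_nonneg.2 hz.2)]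
  push_cast
  rfl

lemma intervalIntegrable_rpow_mul_sub_rpow {a b t : ℝ} (ha : 0 < a) (hb : 0 < b) (ht : 0 < t) :
    IntervalIntegrable (fun z => z ^ (a - 1) * (t - z) ^ (b - 1)) volume 0 t := by
  by_contra hcon
  have h := integral_rpow_mul_sub_rpow ha hb ht
  rw [intervalIntegral.integral_undef hcon] at h
  have := Real.Gamma_pos_of_pos ha
  have := Real.Gamma_pos_of_pos hb
  have := Real.Gamma_pos_of_pos (add_pos ha hb)
  exact absurd h (by positivity)

/-- The Riemann-Liouville integral of order `b` raises the index `w` of the `P` function by `b`. -/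
lemma integral_Pfun_mul_sub_rpow {α : ℝ} (hα : 0 < α) {w b t : ℝ} (hw : -1 < w) (hb : 0 < b)
    (ht : 0 < t) (lam : ℂ) :
    ∫ z in (0 : ℝ)..t, Pfun α w lam z * (((t - z) ^ (b - 1) : ℝ) : ℂ) =
      (Real.Gamma b : ℂ) * Pfun α (w + b) lam t := by
  have ha (n : ℕ) : 0 < α * n + w + 1 := by
    have : 0 ≤ α * n := by positivity
    linarith
  have hF (n : ℕ) (z : ℝ) : PfunTerm α w lam z n * (((t - z) ^ (b - 1) : ℝ) : ℂ) =
      lam ^ n * ((Real.Gamma (α * n + w + 1))⁻¹ : ℝ) *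
        ((z ^ (α * n + w + 1 - 1) * (t - z) ^ (b - 1) : ℝ) : ℂ) := by
    rw [PfunTerm, add_sub_cancel_right]
    push_cast
    ring
  have hval (n : ℕ) : (Real.Gamma (α * n + w + 1))⁻¹ *
      ∫ z in (0 : ℝ)..t, z ^ (α * n + w + 1 - 1) * (t - z) ^ (b - 1) =
      Real.Gamma b * (t ^ (α * n + (w + b)) * (Real.Gamma (α * n + (w + b) + 1))⁻¹) := by
    rw [integral_rpow_mul_sub_rpow (ha n) hb ht,
      show α * n + w + 1 + b - 1 = α * n + (w + b) by ring,
      show α * n + w + 1 + b = α * n + (w + b) + 1 by ring]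
    have := (Real.Gamma_pos_of_pos (ha n)).ne'
    field_simp
  have hint (n : ℕ) : IntervalIntegrable
      (fun z => PfunTerm α w lam z n * (((t - z) ^ (b - 1) : ℝ) : ℂ)) volume 0 t := by
    simp_rw [hF]
    have h := intervalIntegrable_rpow_mul_sub_rpow (ha n) hb ht
    exact IntervalIntegrable.const_mul ⟨h.1.ofReal, h.2.ofReal⟩ _
  have hterm (n : ℕ) : ∫ z in (0 : ℝ)..t, PfunTerm α w lam z n * (((t - z) ^ (b - 1) : ℝ) : ℂ) =
      (Real.Gamma b : ℂ) * PfunTerm α (w + b) lam t n := by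
    simp_rw [hF]
    rw [intervalIntegral.integral_const_mul, intervalIntegral.integral_ofReal, mul_assoc,
      ← Complex.ofReal_mul, hval, PfunTerm]
    push_cast
    ring
  have hnorm (n : ℕ) :
      ∫ z in Ioc 0 t, ‖PfunTerm α w lam z n * (((t - z) ^ (b - 1) : ℝ) : ℂ)‖ =
      Real.Gamma b * ‖PfunTerm α (w + b) lam t n‖ := by
    have hG : 0 < Real.Gamma (α * n + w + 1) := Real.Gamma_pos_of_pos (ha n)
    have hG' : 0 < Real.Gamma (α * n + (w + b) + 1) :=
      Real.Gamma_pos_of_pos (by linarith [ha n])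
    have hcongr : ∫ z in Ioc 0 t, ‖PfunTerm α w lam z n * (((t - z) ^ (b - 1) : ℝ) : ℂ)‖ =
        ∫ z in Ioc 0 t, ‖lam‖ ^ n * (Real.Gamma (α * n + w + 1))⁻¹ *
          (z ^ (α * n + w + 1 - 1) * (t - z) ^ (b - 1)) := by
      refine setIntegral_congr_fun measurableSet_Ioc fun z hz => ?_
      have hz0 : 0 < z := hz.1
      have hz1 : 0 ≤ t - z := sub_nonneg.2 hz.2
      rw [hF, norm_mul, norm_mul, norm_pow, Complex.norm_real, Complex.norm_real,
        Real.norm_of_nonneg (by positivity), Real.norm_of_nonneg (by positivity)]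
    rw [hcongr, ← intervalIntegral.integral_of_le ht.le, intervalIntegral.integral_const_mul,
      mul_assoc, hval, PfunTerm, norm_mul, norm_pow, Complex.norm_real,
      Real.norm_of_nonneg (by positivity)]
    ring
  have hsum := hasSum_integral_of_summable_integral_norm (μ := volume.restrict (Ioc 0 t))
    (fun n => (hint n).1) (by
      simp_rw [hnorm]
      exact (summable_norm_PfunTerm hα _ lam ht).mul_left _)
  rw [intervalIntegral.integral_of_le ht.le]
  calc ∫ z in Ioc 0 t, Pfun α w lam z * (((t - z) ^ (b - 1) : ℝ) : ℂ)
      = ∫ z in Ioc 0 t, ∑' n, PfunTerm α w lam z n * (((t - z) ^ (b - 1) : ℝ) : ℂ) := by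
        refine setIntegral_congr_fun measurableSet_Ioc fun z hz => ?_
        rw [Pfun_eq_tsum α w lam hz.1, tsum_mul_right]
    _ = _ := by
        rw [← hsum.tsum_eq, Pfun_eq_tsum α _ lam ht, ← tsum_mul_left]
        refine tsum_congr fun n => ?_
        rw [← hterm, intervalIntegral.integral_of_le ht.le]

/-- For `α > 0`, `λ ∈ ℂ` and an integer `k` with `0 ≤ k ≤ ⌈α⌉ - 1`,
`P_{α,k}(λ,·)` is an eigenfunction of the Caputo derivative of order `α`
with eigenvalue `λ`. -/
theorem caputo_eigenfunction_Pfun (α : ℝ) (hα : 0 < α) (lam : ℂ)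
    (k : ℕ) (hk : k < ⌈α⌉₊) (t : ℝ) (ht : 0 < t) :
    caputoDeriv α (fun τ => Pfun α (k : ℝ) lam τ) t = lam * Pfun α (k : ℝ) lam t := by
  set m := ⌈α⌉₊ with hm
  have hGamma : Real.Gamma ((k : ℝ) - m + 1) = 0 := by
    rw [Real.Gamma_eq_zero_iff]
    refine ⟨m - (k + 1), ?_⟩
    rw [Nat.cast_sub hk]
    push_cast
    ring
  have hderiv {z : ℝ} (hz : 0 < z) :
      iteratedDeriv m (Pfun α k lam) z = lam * Pfun α (k - m + α) lam z := by
    rw [iteratedDeriv_Pfun hα _ _ _ hz, Pfun_eq_mul_Pfun_add hα hGamma lam hz]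
  change caputoDeriv α (Pfun α k lam) t = _
  rw [caputoDeriv, ← hm]
  split_ifs with h
  · rw [hderiv ht, ← h, sub_add_cancel]
  · have hlt : α < m := lt_of_le_of_ne (Nat.le_ceil α) h
    have hb : 0 < (m : ℝ) - α := sub_pos.2 hlt
    have hw : -1 < (k : ℝ) - m + α := by
      have := Nat.ceil_lt_add_one hα.le
      have : (0 : ℝ) ≤ k := k.cast_nonneg
      linarith
    have hcongr : ∫ z in (0 : ℝ)..t,
        iteratedDeriv m (Pfun α k lam) z * (((t - z) ^ ((m : ℝ) - α - 1) : ℝ) : ℂ) =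
        ∫ z in (0 : ℝ)..t,
          lam * (Pfun α (k - m + α) lam z * (((t - z) ^ ((m : ℝ) - α - 1) : ℝ) : ℂ)) := by
      rw [intervalIntegral.integral_of_le ht.le, intervalIntegral.integral_of_le ht.le]
      refine setIntegral_congr_fun measurableSet_Ioc fun z hz => ?_
      rw [hderiv hz.1, mul_assoc]
    have hG : (Real.Gamma ((m : ℝ) - α) : ℂ) ≠ 0 :=
      Complex.ofReal_ne_zero.2 (Real.Gamma_pos_of_pos hb).ne'
    rw [hcongr, intervalIntegral.integral_const_mul, integral_Pfun_mul_sub_rpow hα hw hb ht,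
      show (k : ℝ) - m + α + (m - α) = k by ring, mul_left_comm, inv_mul_cancel_left₀ hG]
end

section
/- Let α, β > 0, v₁ < α, v₂ < β, λ, σ ∈ ℂ, and set v = v₁ + v₂. Then for every t > 0 the causal convolution of R_{α,v₁}(λ,·) and R_{β,v₂}(σ,·) is given by the convergent series ∫_0^t R_{α,v₁}(λ,t−τ) R_{β,v₂}(σ,τ) dτ = ∑_{k=0}^∞ σᵏ R_{α, v−β(k+1)}(λ,t), and equally = ∑_{j=0}^∞ λʲ R_{β, v−α(j+1)}(σ,t). -/
open MeasureTheory

/-- A crude form of the superexponential growth of the Gamma function. -/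
theorem inv_Gamma_le {s M : ℝ} (hs : 0 < s) (hM : 1 ≤ M) :
    (Real.Gamma s)⁻¹ ≤ M * Real.exp M * M ^ (-s) := by
  have hM0 : 0 < M := by linarith
  have one_le_case : ∀ p : ℝ, 1 ≤ p → Real.exp (-M) * M ^ (p - 1) ≤ Real.Gamma p := by
    intro p hp
    have hp0 : 0 < p := by linarith
    have hint := Real.GammaIntegral_convergent hp0
    calc Real.exp (-M) * M ^ (p - 1)
        = ∫ x in Set.Ioi M, Real.exp (-x) * M ^ (p - 1) := by
          rw [integral_mul_const, integral_exp_neg_Ioi]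
      _ ≤ ∫ x in Set.Ioi M, Real.exp (-x) * x ^ (p - 1) := by
          refine setIntegral_mono_on ((integrableOn_exp_neg_Ioi M).mul_const _)
            (hint.mono_set (Set.Ioi_subset_Ioi hM0.le)) measurableSet_Ioi fun x hx => ?_
          have hx' : M ≤ x := le_of_lt hx
          have hp1 : 0 ≤ p - 1 := by linarith
          gcongr
      _ ≤ ∫ x in Set.Ioi (0 : ℝ), Real.exp (-x) * x ^ (p - 1) := by
          refine setIntegral_mono_set hint ?_ (Set.Ioi_subset_Ioi hM0.le).eventuallyLE
          filter_upwards [ae_restrict_mem measurableSet_Ioi] with x hx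
          have hx' : (0 : ℝ) ≤ x := le_of_lt hx
          simp only [Pi.zero_apply]
          positivity
      _ = Real.Gamma p := (Real.Gamma_eq_integral hp0).symm
  have key : Real.exp (-M) * M ^ (s - 1) ≤ Real.Gamma s := by
    rcases le_or_gt 1 s with h | h
    · exact one_le_case s h
    · have h1 := one_le_case (s + 1) (by linarith)
      rw [Real.Gamma_add_one hs.ne'] at h1
      calc Real.exp (-M) * M ^ (s - 1) ≤ Real.exp (-M) * M ^ (s + 1 - 1) := by
            gcongr
            linarith
        _ ≤ s * Real.Gamma s := h1
        _ ≤ Real.Gamma s :=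
          mul_le_of_le_one_left (Real.Gamma_pos_of_pos hs).le h.le
  have hpos : 0 < Real.exp (-M) * M ^ (s - 1) := by positivity
  calc (Real.Gamma s)⁻¹ ≤ (Real.exp (-M) * M ^ (s - 1))⁻¹ := by gcongr
    _ = M * Real.exp M * M ^ (-s) := by
      rw [Real.exp_neg, Real.rpow_sub_one hM0.ne', Real.rpow_neg hM0.le]
      field_simp

/-- The normalized power function, whose causal convolutions form a semigroup in `p`. -/
noncomputable def gammaKernel (p t : ℝ) : ℝ := t ^ (p - 1) * (Real.Gamma p)⁻¹

theorem gammaKernel_nonneg {p t : ℝ} (hp : 0 < p) (ht : 0 ≤ t) : 0 ≤ gammaKernel p t := by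
  have := Real.Gamma_pos_of_pos hp
  unfold gammaKernel
  positivity

theorem gammaKernel_pos {p t : ℝ} (hp : 0 < p) (ht : 0 < t) : 0 < gammaKernel p t := by
  have := Real.Gamma_pos_of_pos hp
  unfold gammaKernel
  positivity

theorem integral_gammaKernel_mul {p q t : ℝ} (hp : 0 < p) (hq : 0 < q) (ht : 0 < t) :
    ∫ τ in (0 : ℝ)..t, gammaKernel p (t - τ) * gammaKernel q τ = gammaKernel (p + q) t := by
  have h := Complex.betaIntegral_scaled q p ht
  rw [Complex.betaIntegral_eq_Gamma_mul_div _ _ (by simpa using hq) (by simpa using hp)] at h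
  have hreal : ∫ τ in (0 : ℝ)..t, τ ^ (q - 1) * (t - τ) ^ (p - 1) =
      t ^ (q + p - 1) * (Real.Gamma q * Real.Gamma p / Real.Gamma (q + p)) := by
    apply Complex.ofReal_injective
    rw [← intervalIntegral.integral_ofReal]
    push_cast [Complex.ofReal_cpow ht.le, ← Complex.Gamma_ofReal]
    rw [← h]
    refine intervalIntegral.integral_congr fun τ hτ => ?_
    rw [Set.uIcc_of_le ht.le] at hτ
    rw [Complex.ofReal_cpow hτ.1, Complex.ofReal_cpow (sub_nonneg.2 hτ.2)]
    push_cast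
    rfl
  have hp' := (Real.Gamma_pos_of_pos hp).ne'
  have hq' := (Real.Gamma_pos_of_pos hq).ne'
  calc ∫ τ in (0 : ℝ)..t, gammaKernel p (t - τ) * gammaKernel q τ
      = ∫ τ in (0 : ℝ)..t,
          ((Real.Gamma p)⁻¹ * (Real.Gamma q)⁻¹) * (τ ^ (q - 1) * (t - τ) ^ (p - 1)) := by
        congr 1 with τ
        unfold gammaKernel
        ring
    _ = gammaKernel (p + q) t := by
        rw [intervalIntegral.integral_const_mul, hreal, gammaKernel, add_comm q p]
        field_simp

theorem intervalIntegrable_gammaKernel_mul {p q t : ℝ} (hp : 0 < p) (hq : 0 < q) (ht : 0 < t) :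
    IntervalIntegrable (fun τ => gammaKernel p (t - τ) * gammaKernel q τ) volume 0 t :=
  not_imp_comm.1 intervalIntegral.integral_undef
    (by rw [integral_gammaKernel_mul hp hq ht]; exact (gammaKernel_pos (by positivity) ht).ne')

theorem eventually_rpow_neg_mul_lt_one {α : ℝ} (hα : 0 < α) (x : ℝ) :
    ∀ᶠ M : ℝ in Filter.atTop, M ^ (-α) * x < 1 := by
  have h := (tendsto_rpow_neg_atTop hα).mul_const x
  rw [zero_mul] at h
  exact h.eventually_lt_const one_pos

theorem summable_pow_mul_gammaKernel {α β c t : ℝ} (hα : 0 < α) (hβ : 0 < β) (hc : 0 < c)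
    (ht : 0 < t) {x y : ℝ} (hx : 0 ≤ x) (hy : 0 ≤ y) :
    Summable fun p : ℕ × ℕ => y ^ p.1 * x ^ p.2 * gammaKernel (α * p.2 + β * p.1 + c) t := by
  obtain ⟨M, hMx, hMy, hM⟩ := ((eventually_rpow_neg_mul_lt_one hα (x * t ^ α)).and
    ((eventually_rpow_neg_mul_lt_one hβ (y * t ^ β)).and (Filter.eventually_ge_atTop 1))).exists
  have hM0 : 0 < M := by linarith
  have hgeom : Summable fun p : ℕ × ℕ =>
      (M ^ (-β) * (y * t ^ β)) ^ p.1 * (M ^ (-α) * (x * t ^ α)) ^ p.2 :=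
    (summable_geometric_of_lt_one (by positivity) hMy).mul_of_nonneg
      (summable_geometric_of_lt_one (by positivity) hMx)
      (fun _ => by positivity) (fun _ => by positivity)
  refine (hgeom.mul_left (M * Real.exp M * M ^ (-c) * t ^ (c - 1))).of_nonneg_of_le
    (fun p => ?_) fun p => ?_
  · have := gammaKernel_nonneg (p := α * p.2 + β * p.1 + c) (by positivity) ht.le
    positivity
  · have hpow (z a : ℝ) (n : ℕ) (hz : 0 < z) : z ^ (a * n) = (z ^ a) ^ n := by
      rw [Real.rpow_mul hz.le, Real.rpow_natCast]
    calc y ^ p.1 * x ^ p.2 * gammaKernel (α * p.2 + β * p.1 + c) t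
        ≤ y ^ p.1 * x ^ p.2 * (t ^ (α * p.2 + β * p.1 + c - 1) *
          (M * Real.exp M * M ^ (-(α * p.2 + β * p.1 + c)))) := by
          unfold gammaKernel
          gcongr
          exact inv_Gamma_le (by positivity) hM
      _ = _ := by
          rw [show α * p.2 + β * p.1 + c - 1 = α * p.2 + β * p.1 + (c - 1) by ring,
            show -(α * p.2 + β * p.1 + c) = (-α) * p.2 + (-β) * p.1 + (-c) by ring,
            Real.rpow_add ht, Real.rpow_add ht, Real.rpow_add hM0, Real.rpow_add hM0,
            hpow t α _ ht, hpow t β _ ht, hpow M (-α) _ hM0, hpow M (-β) _ hM0]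
          ring

theorem summable_norm_pow_mul_gammaKernel {α c t : ℝ} (hα : 0 < α) (hc : 0 < c) (ht : 0 < t)
    (lam : ℂ) : Summable fun n : ℕ => ‖lam ^ n * (gammaKernel (α * n + c) t : ℂ)‖ := by
  have h := (summable_pow_mul_gammaKernel hα one_pos hc ht (norm_nonneg lam)
    zero_le_one).comp_injective (Prod.mk_right_injective (0 : ℕ))
  refine h.congr fun n => ?_
  have := gammaKernel_nonneg (p := α * n + c) (by positivity) ht.le
  simp [abs_of_nonneg this]

theorem hasSum_Rfun {α v t : ℝ} (hα : 0 < α) (hv : v < α) (ht : 0 < t) (lam : ℂ) :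
    HasSum (fun n : ℕ => lam ^ n * (gammaKernel (α * n + (α - v)) t : ℂ)) (Rfun α v lam t) := by
  refine ((summable_norm_pow_mul_gammaKernel hα (sub_pos.2 hv) ht lam).of_norm.hasSum_iff).2 ?_
  rw [Rfun, mlE, ← tsum_mul_left]
  congr 1 with n
  rw [gammaKernel, show α * n + (α - v) - 1 = (α - v - 1) + α * n by ring, Real.rpow_add ht,
    Real.rpow_mul ht.le, Real.rpow_natCast, Complex.Gamma_ofReal]
  push_cast
  ring

/-- The convolution of two `R` functions as a sum over the second parameter's power series. -/
theorem hasSum_conv_Rfun {α β v₁ v₂ t : ℝ} (hα : 0 < α) (hβ : 0 < β)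
    (hv₁ : v₁ < α) (hv₂ : v₂ < β) (lam sig : ℂ) (ht : 0 < t) :
    HasSum (fun k : ℕ => sig ^ k * Rfun α ((v₁ + v₂) - β * ((k : ℝ) + 1)) lam t)
      (∫ τ in (0 : ℝ)..t, Rfun α v₁ lam (t - τ) * Rfun β v₂ sig τ) := by
  have ha : 0 < α - v₁ := sub_pos.2 hv₁
  have hb : 0 < β - v₂ := sub_pos.2 hv₂
  let G (p : ℕ × ℕ) (τ : ℝ) : ℝ :=
    gammaKernel (α * p.2 + (α - v₁)) (t - τ) * gammaKernel (β * p.1 + (β - v₂)) τ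
  let F (p : ℕ × ℕ) (τ : ℝ) : ℂ := sig ^ p.1 * lam ^ p.2 * (G p τ : ℂ)
  let w (p : ℕ × ℕ) : ℝ := gammaKernel (α * p.2 + β * p.1 + ((α - v₁) + (β - v₂))) t
  have integral_G (p : ℕ × ℕ) : ∫ τ in Set.Ioo 0 t, G p τ = w p := by
    rw [← integral_Ioc_eq_integral_Ioo, ← intervalIntegral.integral_of_le ht.le,
      integral_gammaKernel_mul (by positivity) (by positivity) ht]
    congr 1
    ring
  have integrable_G (p : ℕ × ℕ) : IntegrableOn (G p) (Set.Ioo 0 t) :=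
    ((intervalIntegrable_iff_integrableOn_Ioc_of_le ht.le).1
      (intervalIntegrable_gammaKernel_mul (by positivity) (by positivity) ht)).mono_set
      Set.Ioo_subset_Ioc_self
  have integral_F (p : ℕ × ℕ) :
      ∫ τ in Set.Ioo 0 t, F p τ = sig ^ p.1 * lam ^ p.2 * (w p : ℂ) := by
    rw [integral_const_mul, integral_complex_ofReal, integral_G]
  have integral_norm_F (p : ℕ × ℕ) :
      ∫ τ in Set.Ioo 0 t, ‖F p τ‖ = ‖sig‖ ^ p.1 * ‖lam‖ ^ p.2 * w p := by
    rw [← integral_G, ← integral_const_mul]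
    refine setIntegral_congr_fun measurableSet_Ioo fun τ hτ => ?_
    have hG : 0 ≤ G p τ := mul_nonneg
      (gammaKernel_nonneg (by positivity) (sub_pos.2 hτ.2).le)
      (gammaKernel_nonneg (by positivity) hτ.1.le)
    simp [F, abs_of_nonneg hG]
  have summable_norm : Summable fun p : ℕ × ℕ => ‖sig‖ ^ p.1 * ‖lam‖ ^ p.2 * w p :=
    summable_pow_mul_gammaKernel hα hβ (add_pos ha hb) ht (norm_nonneg _) (norm_nonneg _)
  have hasSum_F : HasSum (fun p => ∫ τ in Set.Ioo 0 t, F p τ)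
      (∫ τ in Set.Ioo 0 t, ∑' p, F p τ) :=
    hasSum_integral_of_summable_integral_norm
      (fun p => (integrable_G p).ofReal.const_mul _)
      (by simpa only [integral_norm_F] using summable_norm)
  have conv_eq : ∫ τ in (0 : ℝ)..t, Rfun α v₁ lam (t - τ) * Rfun β v₂ sig τ =
      ∫ τ in Set.Ioo 0 t, ∑' p, F p τ := by
    rw [intervalIntegral.integral_of_le ht.le, integral_Ioc_eq_integral_Ioo]
    refine setIntegral_congr_fun measurableSet_Ioo fun τ hτ => ?_
    have hτ' := sub_pos.2 hτ.2
    rw [mul_comm, ← (hasSum_Rfun hα hv₁ hτ' lam).tsum_eq, ← (hasSum_Rfun hβ hv₂ hτ.1 sig).tsum_eq,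
      tsum_mul_tsum_of_summable_norm (summable_norm_pow_mul_gammaKernel hβ hb hτ.1 sig)
        (summable_norm_pow_mul_gammaKernel hα ha hτ' lam)]
    congr 1 with p
    simp only [F, G]
    push_cast
    ring
  rw [conv_eq]
  refine hasSum_F.prod_fiberwise fun k => ?_
  simp only [integral_F]
  have hk : (v₁ + v₂) - β * ((k : ℝ) + 1) < α := by
    nlinarith [mul_nonneg hβ.le (Nat.cast_nonneg (α := ℝ) k)]
  refine ((hasSum_Rfun hα hk ht lam).mul_left (sig ^ k)).congr_fun fun n => ?_
  rw [mul_assoc, show w (k, n) = gammaKernel (α * n + (α - (v₁ + v₂ - β * (k + 1)))) t by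
    simp only [w]; ring_nf]

/-- Convolution-to-series identity for `R` functions: for `α, β > 0`,
`v₁ < α`, `v₂ < β`, `v = v₁ + v₂` and `t > 0`, the causal convolution of
`R_{α,v₁}(λ,·)` and `R_{β,v₂}(σ,·)` equals both convergent series
`∑_k σ^k R_{α,v-β(k+1)}(λ,t)` and `∑_j λ^j R_{β,v-α(j+1)}(σ,t)`. -/
theorem conv_Rfun_to_series (α β v₁ v₂ : ℝ) (hα : 0 < α) (hβ : 0 < β)
    (hv₁ : v₁ < α) (hv₂ : v₂ < β) (lam sig : ℂ) (t : ℝ) (ht : 0 < t) :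
    Summable (fun k : ℕ => sig ^ k * Rfun α ((v₁ + v₂) - β * ((k : ℝ) + 1)) lam t) ∧
    Summable (fun j : ℕ => lam ^ j * Rfun β ((v₁ + v₂) - α * ((j : ℝ) + 1)) sig t) ∧
    ((∫ τ in (0 : ℝ)..t, Rfun α v₁ lam (t - τ) * Rfun β v₂ sig τ) =
      ∑' k : ℕ, sig ^ k * Rfun α ((v₁ + v₂) - β * ((k : ℝ) + 1)) lam t) ∧
    ((∫ τ in (0 : ℝ)..t, Rfun α v₁ lam (t - τ) * Rfun β v₂ sig τ) =
      ∑' j : ℕ, lam ^ j * Rfun β ((v₁ + v₂) - α * ((j : ℝ) + 1)) sig t) := by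
  have h₁ := hasSum_conv_Rfun hα hβ hv₁ hv₂ lam sig ht
  have h₂ := hasSum_conv_Rfun hβ hα hv₂ hv₁ sig lam ht
  have hswap : ∫ τ in (0 : ℝ)..t, Rfun β v₂ sig (t - τ) * Rfun α v₁ lam τ =
      ∫ τ in (0 : ℝ)..t, Rfun α v₁ lam (t - τ) * Rfun β v₂ sig τ := by
    simpa [mul_comm] using intervalIntegral.integral_comp_sub_left (a := 0) (b := t)
      (fun τ => Rfun α v₁ lam (t - τ) * Rfun β v₂ sig τ) t
  rw [hswap, add_comm v₂ v₁] at h₂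
  exact ⟨h₁.summable, h₂.summable, h₁.tsum_eq.symm, h₂.tsum_eq.symm⟩
end

section
/- Generalized Euler identity for R functions: for every positive integer N, every real α > 0, every v < α, every λ ∈ ℂ, and every t > 0, R_{α,v}(λ,t) = ∑_{ℓ=0}^{N−1} λ^{N−ℓ−1} R_{Nα, v+αℓ}(λ^N, t). -/
open MeasureTheory

open Set in
/-- Tail bound for the Gamma integral: `A ^ (x - 1) * exp (-A) ≤ Γ(x)` for `1 ≤ x`. -/
theorem Real.rpow_sub_one_mul_exp_neg_le_Gamma {A x : ℝ} (hA : 0 < A) (hx : 1 ≤ x) :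
    A ^ (x - 1) * Real.exp (-A) ≤ Real.Gamma x := by
  have hint := Real.GammaIntegral_convergent (zero_lt_one.trans_le hx)
  have hsub : Ioi A ⊆ Ioi (0 : ℝ) := Ioi_subset_Ioi hA.le
  rw [Real.Gamma_eq_integral (zero_lt_one.trans_le hx)]
  calc A ^ (x - 1) * Real.exp (-A) = ∫ s in Ioi A, Real.exp (-s) * A ^ (x - 1) := by
        rw [integral_mul_const, integral_exp_neg_Ioi, mul_comm]
    _ ≤ ∫ s in Ioi A, Real.exp (-s) * s ^ (x - 1) := by
        refine setIntegral_mono_on ((integrableOn_exp_neg_Ioi A).mul_const _)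
          (hint.mono_set hsub) measurableSet_Ioi fun s hs => ?_
        have hs' : A ≤ s := (mem_Ioi.mp hs).le
        have : 0 ≤ x - 1 := by linarith
        gcongr
    _ ≤ ∫ s in Ioi 0, Real.exp (-s) * s ^ (x - 1) := by
        refine setIntegral_mono_set hint ?_ hsub.eventuallyLE
        filter_upwards [ae_restrict_mem measurableSet_Ioi] with s hs
        exact mul_nonneg (Real.exp_pos _).le (Real.rpow_nonneg (mem_Ioi.mp hs).le _)

/-- The Mittag-Leffler series converges everywhere. -/
theorem summable_mlE (α β : ℝ) (hα : 0 < α) (z : ℂ) :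
    Summable fun n : ℕ => z ^ n * (Complex.Gamma ((α * n + β : ℝ) : ℂ))⁻¹ := by
  obtain ⟨A, hA, hAα⟩ : ∃ A : ℝ, 0 < A ∧ A ^ α = ‖z‖ + 1 :=
    ⟨(‖z‖ + 1) ^ α⁻¹, by positivity, Real.rpow_inv_rpow (by positivity) hα.ne'⟩
  have hr : ‖z‖ / (‖z‖ + 1) < 1 := (div_lt_one (by positivity)).2 (by linarith)
  have hgeom := (summable_geometric_of_lt_one (by positivity) hr).mul_left
    (A ^ (β - 1) * Real.exp (-A))⁻¹
  have hlim : Filter.Tendsto (fun n : ℕ => α * n + β) Filter.atTop Filter.atTop :=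
    Filter.tendsto_atTop_add_const_right _ _
      (tendsto_natCast_atTop_atTop.const_mul_atTop hα)
  refine hgeom.of_norm_bounded_eventually_nat ?_
  filter_upwards [hlim.eventually_ge_atTop 1] with n hn
  have hG := Real.rpow_sub_one_mul_exp_neg_le_Gamma hA hn
  have hpow : A ^ (α * n + β - 1) = (‖z‖ + 1) ^ n * A ^ (β - 1) := by
    rw [add_sub_assoc, Real.rpow_add hA, Real.rpow_mul hA.le, hAα, Real.rpow_natCast]
  rw [Complex.Gamma_ofReal, norm_mul, norm_pow, norm_inv, Complex.norm_real,
    Real.norm_of_nonneg (Real.Gamma_pos_of_pos (by linarith)).le]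
  calc ‖z‖ ^ n * (Real.Gamma (α * n + β))⁻¹
      ≤ ‖z‖ ^ n * (A ^ (α * n + β - 1) * Real.exp (-A))⁻¹ := by gcongr
    _ = (A ^ (β - 1) * Real.exp (-A))⁻¹ * (‖z‖ / (‖z‖ + 1)) ^ n := by
        rw [hpow, div_pow, div_eq_mul_inv]
        simp only [mul_inv]
        ring

/-- Splitting the Mittag-Leffler series along residue classes modulo `N`. -/
theorem mlE_eq_sum_range {N : ℕ} (hN : 0 < N) {α : ℝ} (β : ℝ) (hα : 0 < α) (z : ℂ) :
    mlE α β z = ∑ k ∈ Finset.range N, z ^ k * mlE (N * α) (β + α * k) (z ^ N) := by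
  have : NeZero N := ⟨hN.ne'⟩
  have hs := (Equiv.prodComm (Fin N) ℕ).trans (Nat.divModEquiv N).symm
    |>.summable_iff.mpr (summable_mlE α β hα z)
  rw [mlE, ← ((Equiv.prodComm (Fin N) ℕ).trans (Nat.divModEquiv N).symm).tsum_eq]
  refine (Summable.tsum_prod hs).trans ?_
  rw [tsum_fintype, ← Fin.sum_univ_eq_sum_range
    (fun k => z ^ k * mlE (N * α) (β + α * k) (z ^ N))]
  refine Finset.sum_congr rfl fun k _ => ?_
  rw [mlE, ← tsum_mul_left]
  refine tsum_congr fun m => ?_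
  have hidx : α * ((m * N + k : ℕ) : ℝ) + β = N * α * m + (β + α * k) := by
    push_cast
    ring
  simp only [Function.comp_apply, Equiv.trans_apply, Equiv.prodComm_apply, Prod.swap_prod_mk,
    Nat.divModEquiv_symm_apply]
  rw [hidx]
  ring

/-- Generalized Euler identity for `R` functions:
`R_{α,v}(λ,t) = ∑_{ℓ=0}^{N-1} λ^(N-ℓ-1) R_{Nα, v+αℓ}(λ^N, t)`. -/
theorem Rfun_euler_expansion (N : ℕ) (hN : 0 < N) (α v : ℝ) (hα : 0 < α) (hv : v < α)
    (lam : ℂ) (t : ℝ) (ht : 0 < t) :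
    Rfun α v lam t =
      ∑ ℓ ∈ Finset.range N,
        lam ^ (N - ℓ - 1) * Rfun ((N : ℝ) * α) (v + α * (ℓ : ℝ)) (lam ^ N) t := by
  rw [Rfun, mlE_eq_sum_range hN _ hα, ← Finset.sum_range_reflect, Finset.mul_sum]
  refine Finset.sum_congr rfl fun ℓ hℓ => ?_
  have hℓN : ℓ + 1 ≤ N := Finset.mem_range.mp hℓ
  obtain ⟨k, rfl⟩ := Nat.exists_eq_add_of_le hℓN
  have hk : ℓ + 1 + k - 1 - ℓ = k := by omega
  have hk' : ℓ + 1 + k - ℓ - 1 = k := by omega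
  have hβ : ((ℓ + 1 + k : ℕ) : ℝ) * α - (v + α * ℓ) = α - v + α * k := by
    push_cast
    ring
  have hz : (lam * ((t ^ α : ℝ) : ℂ)) ^ (ℓ + 1 + k) =
      lam ^ (ℓ + 1 + k) * ((t ^ (((ℓ + 1 + k : ℕ) : ℝ) * α) : ℝ) : ℂ) := by
    rw [mul_pow, ← Complex.ofReal_pow, ← Real.rpow_natCast (t ^ α), ← Real.rpow_mul ht.le,
      mul_comm α]
  have ht' : t ^ (α - v + α * k - 1) = t ^ (α - v - 1) * (t ^ α) ^ k := by
    rw [← Real.rpow_natCast (t ^ α), ← Real.rpow_mul ht.le, ← Real.rpow_add ht]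
    ring_nf
  rw [hk, hk', Rfun, hβ, hz, ht']
  push_cast
  ring
end
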